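/- The field k(X)_0 is the splitting field over K = k(q_r : r = 1, 2, …) of the polynomial f(t) = ∏_{i≠j} (t − x_i/x_j). -/

import Mathlib

noncomputable section

open scoped Classical

abbrev RF (k : Type) [Field k] (n : ℕ) := FractionRing (MvPolynomial (Fin n) k)

def xv (k : Type) [Field k] (n : ℕ) (i : Fin n) : RF k n :=
  algebraMap (MvPolynomial (Fin n) k) (RF k n) (MvPolynomial.X i)

/-- The set of ratios `x_i / x_j`, `i ≠ j`, generating `k(X)₀`. -/
def ratioSet (k : Type) [Field k] (n : ℕ) : Set (RF k n) :=
  {r | ∃ i j : Fin n, i ≠ j ∧ r = xv k n i / xv k n j}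

/-- The observable `q_r = tr(X^r) · tr(X^{-r})`. -/
def qObs (k : Type) [Field k] (n : ℕ) (r : ℤ) : RF k n :=
  (∑ i, xv k n i ^ r) * (∑ i, xv k n i ^ (-r))

/-- The set of all observables `q_r`, `r = 1, 2, …`. -/
def obsSet (k : Type) [Field k] (n : ℕ) : Set (RF k n) :=
  {a | ∃ r : ℕ, 1 ≤ r ∧ a = qObs k n (r : ℤ)}

/-- The polynomial `f(t) = ∏_{i ≠ j} (t - x_i/x_j)`. -/
def fPoly (k : Type) [Field k] (n : ℕ) : Polynomial (RF k n) :=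
  ∏ p ∈ Finset.univ.filter (fun p : Fin n × Fin n => p.1 ≠ p.2),
    (Polynomial.X - Polynomial.C (xv k n p.1 / xv k n p.2))

/-- Over a field of characteristic zero, a subfield containing all the positive power sums of a
finite family contains its elementary symmetric functions. -/
theorem aeval_esymm_mem_of_sum_pow_mem {k L σ : Type*} [Field k] [Field L] [Algebra k L]
    [CharZero L] [Fintype σ] (S : IntermediateField k L) (v : σ → L)
    (h : ∀ r : ℕ, 1 ≤ r → ∑ i, v i ^ r ∈ S) (m : ℕ) :
    MvPolynomial.aeval v (MvPolynomial.esymm σ ℤ m) ∈ S := by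
  induction m using Nat.strong_induction_on with
  | _ m ih =>
  rcases Nat.eq_zero_or_pos m with rfl | hm
  · simp [S.one_mem]
  have key := congrArg (MvPolynomial.aeval v) (MvPolynomial.mul_esymm_eq_sum σ ℤ m)
  simp only [map_mul, map_natCast, map_pow, map_neg, map_one, map_sum, MvPolynomial.psum,
    MvPolynomial.aeval_X] at key
  have hm0 : (m : L) ≠ 0 := Nat.cast_ne_zero.mpr hm.ne'
  rw [eq_div_of_mul_eq hm0 ((mul_comm _ _).trans key)]
  have hsign (a : ℕ) : (-1 : L) ^ a ∈ S := pow_mem (neg_mem S.one_mem) a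
  refine S.div_mem (mul_mem (hsign _) (sum_mem fun a ha => ?_)) (natCast_mem S m)
  obtain ⟨ha, hlt⟩ := Finset.mem_filter.mp ha
  rw [Finset.HasAntidiagonal.mem_antidiagonal] at ha
  exact mul_mem (mul_mem (hsign _) (ih _ hlt)) (h _ (by omega))

/-- Over a field of characteristic zero, a subfield containing all the positive power sums of a
finite family contains the coefficients of the monic polynomial with these roots. -/
theorem coeff_prod_X_sub_C_mem_of_sum_pow_mem {k L σ : Type*} [Field k] [Field L] [Algebra k L]
    [CharZero L] [Fintype σ] (S : IntermediateField k L) (v : σ → L)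
    (h : ∀ r : ℕ, 1 ≤ r → ∑ i, v i ^ r ∈ S) (m : ℕ) :
    (∏ i, (Polynomial.X - Polynomial.C (v i))).coeff m ∈ S := by
  have hprod : ∏ i, (Polynomial.X - Polynomial.C (v i)) =
      ((Finset.univ.val.map v).map fun t => Polynomial.X - Polynomial.C t).prod := by
    rw [Multiset.map_map]; rfl
  rw [hprod]
  by_cases hm : m ≤ Multiset.card (Finset.univ.val.map v)
  · rw [Multiset.prod_X_sub_C_coeff _ hm, ← MvPolynomial.aeval_esymm_eq_multiset_esymm σ ℤ]
    exact mul_mem (pow_mem (neg_mem S.one_mem) _) (aeval_esymm_mem_of_sum_pow_mem S v h _)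
  · rw [Polynomial.coeff_eq_zero_of_natDegree_lt]
    · exact S.zero_mem
    · rw [Polynomial.natDegree_multiset_prod_X_sub_C_eq_card]
      omega

theorem xv_ne_zero (k : Type) [Field k] (n : ℕ) (i : Fin n) : xv k n i ≠ 0 := by
  simp [xv]

theorem qObs_natCast_eq_sum (k : Type) [Field k] (n r : ℕ) :
    qObs k n r = ∑ p : Fin n × Fin n, (xv k n p.1 / xv k n p.2) ^ r := by
  simp [qObs, Finset.sum_mul_sum, Fintype.sum_prod_type, div_eq_mul_inv, mul_pow]

theorem sum_ratio_pow_eq (k : Type) [Field k] (n r : ℕ) :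
    ∑ p : {p : Fin n × Fin n // p.1 ≠ p.2}, (xv k n p.1.1 / xv k n p.1.2) ^ r =
      qObs k n r - n := by
  rw [qObs_natCast_eq_sum, eq_sub_iff_add_eq,
    ← Finset.sum_filter_add_sum_filter_not Finset.univ (fun p : Fin n × Fin n => p.1 ≠ p.2)]
  congr 1
  · exact (Finset.sum_subtype _ (by simp)
      (fun p : Fin n × Fin n => (xv k n p.1 / xv k n p.2) ^ r)).symm
  · simp [Finset.sum_filter, Fintype.sum_prod_type, xv_ne_zero]

theorem obsSet_subset_adjoin_ratioSet (k : Type) [Field k] (n : ℕ) :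
    obsSet k n ⊆ IntermediateField.adjoin k (ratioSet k n) := by
  rintro _ ⟨r, -, rfl⟩
  rw [qObs_natCast_eq_sum]
  refine sum_mem fun p _ => pow_mem ?_ r
  by_cases hp : p.1 = p.2
  · rw [hp, div_self (xv_ne_zero k n _)]
    exact one_mem _
  · exact IntermediateField.subset_adjoin _ _ ⟨_, _, hp, rfl⟩

/-- `k(X)₀` is the splitting field of `f(t)` over `K = k(q_r : r ≥ 1)`:
the coefficients of `f` lie in `K`, and `k(X)₀` is generated over `K` by
the roots `x_i/x_j` of `f`. -/
theorem stmt4 (k : Type) [Field k] [CharZero k] (n : ℕ) :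
    (∀ m : ℕ, (fPoly k n).coeff m ∈ IntermediateField.adjoin k (obsSet k n)) ∧
      IntermediateField.adjoin k (obsSet k n ∪ ratioSet k n) =
        IntermediateField.adjoin k (ratioSet k n) := by
  refine ⟨fun m => ?_, ?_⟩
  · have : CharZero (RF k n) := charZero_of_injective_algebraMap (algebraMap k (RF k n)).injective
    have hf : fPoly k n = ∏ p : {p : Fin n × Fin n // p.1 ≠ p.2},
        (Polynomial.X - Polynomial.C (xv k n p.1.1 / xv k n p.1.2)) :=
      Finset.prod_subtype _ (by simp) (fun p : Fin n × Fin n =>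
        Polynomial.X - Polynomial.C (xv k n p.1 / xv k n p.2))
    rw [hf]
    refine coeff_prod_X_sub_C_mem_of_sum_pow_mem _ _ (fun r hr => ?_) m
    rw [sum_ratio_pow_eq]
    exact sub_mem (IntermediateField.subset_adjoin _ _ ⟨r, hr, rfl⟩) (natCast_mem _ n)
  · refine le_antisymm ?_ (IntermediateField.adjoin.mono _ _ _ Set.subset_union_right)
    exact IntermediateField.adjoin_le_iff.mpr (Set.union_subset
      (obsSet_subset_adjoin_ratioSet k n) (IntermediateField.subset_adjoin _ _))
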